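/- Let 0 < r ≤ 1 and let γ be convex on [a,b] such that 0 ≤ γ'_R(x) ≤ 1 and 0 ≤ γ'_L(x) ≤ 1 at every point where these one-sided derivatives are defined, and such that (b−a)·(γ'_L(b)−γ'_R(a)) ≤ 2. Let ν₁ ≥ 0 be an integer and let a ≤ s⁰ < s¹ < ⋯ < s^{ν₁} ≤ b be points such that W(Γ,[s^ν, s^{ν+2}]) > r for every integer ν with 0 ≤ ν ≤ ν₁ − 3. Then ν₁ ≤ 2 + 16·r^{−1/2}. -/

import Mathlib

open Set

/-- `segA γR γL a b` is `A(Γ,[a,b]) = (γ'_L(b) − γ'_R(a))/(1 + γ'_L(b)·γ'_R(a))`. -/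
noncomputable def segA (γR γL : ℝ → ℝ) (a b : ℝ) : ℝ :=
  (γL b - γR a) / (1 + γL b * γR a)

/-- `segL γ a b` is `L(Γ,[a,b]) = ‖Γ(b) − Γ(a)‖` with `Γ(t) = (t, γ t)` (Euclidean norm). -/
noncomputable def segL (γ : ℝ → ℝ) (a b : ℝ) : ℝ :=
  Real.sqrt ((b - a) ^ 2 + (γ b - γ a) ^ 2)

/-- `segW γ γR γL a b` is `W(Γ,[a,b]) = L(Γ,[a,b])·A(Γ,[a,b])`. -/
noncomputable def segW (γ γR γL : ℝ → ℝ) (a b : ℝ) : ℝ :=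
  segL γ a b * segA γR γL a b

/-- `γR` and `γL` are the one-sided derivatives of `γ` on the interval `[a,b]`:
the right derivative is defined on `[a,b)` and the left derivative on `(a,b]`. -/
def HasOneSidedDerivs (γ γR γL : ℝ → ℝ) (a b : ℝ) : Prop :=
  (∀ x ∈ Set.Ico a b, HasDerivWithinAt γ (γR x) (Set.Ioc x b) x) ∧
  (∀ x ∈ Set.Ioc a b, HasDerivWithinAt γ (γL x) (Set.Ico a x) x)

theorem ConvexOn.leftDeriv_le_rightDeriv_of_hasDerivWithinAt {S : Set ℝ} {f : ℝ → ℝ} {x y z l m : ℝ}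
    (hf : ConvexOn ℝ S f) (hx : x ∈ S) (hz : z ∈ S) (hxy : x < y) (hyz : y < z)
    (hl : HasDerivWithinAt f l (Iio y) y) (hm : HasDerivWithinAt f m (Ioi y) y) : l ≤ m := by
  have hIcc : Icc x z ⊆ S := hf.1.ordConnected.out hx hz
  have slope_le : ∀ u ∈ Ioo x y, ∀ v ∈ Ioo y z, slope f y u ≤ slope f y v := by
    intro u hu v hv
    rw [slope_comm, slope_def_field, slope_def_field]
    exact hf.slope_mono_adjacent (hIcc ⟨hu.1.le, by linarith [hu.2]⟩)
      (hIcc ⟨by linarith [hv.1], hv.2.le⟩) hu.2 hv.1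
  refine le_of_tendsto ((hasDerivWithinAt_iff_tendsto_slope' self_notMem_Iio).mp hl) ?_
  filter_upwards [Ioo_mem_nhdsLT hxy] with u hu
  refine ge_of_tendsto ((hasDerivWithinAt_iff_tendsto_slope' self_notMem_Ioi).mp hm) ?_
  filter_upwards [Ioo_mem_nhdsGT hyz] with v hv
  exact slope_le u hu v hv

namespace HasOneSidedDerivs

variable {γ γR γL : ℝ → ℝ} {a b : ℝ}

theorem hasDerivWithinAt_Ioi (h : HasOneSidedDerivs γ γR γL a b) {x : ℝ} (hx : x ∈ Ico a b) :
    HasDerivWithinAt γ (γR x) (Ioi x) x :=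
  (h.1 x hx).mono_of_mem_nhdsWithin (Ioc_mem_nhdsGT hx.2)

theorem hasDerivWithinAt_Iio (h : HasOneSidedDerivs γ γR γL a b) {x : ℝ} (hx : x ∈ Ioc a b) :
    HasDerivWithinAt γ (γL x) (Iio x) x :=
  (h.2 x hx).mono_of_mem_nhdsWithin (Ico_mem_nhdsLT hx.1)

theorem right_le_slope (h : HasOneSidedDerivs γ γR γL a b) (hconv : ConvexOn ℝ (Icc a b) γ)
    {x y : ℝ} (hax : a ≤ x) (hxy : x < y) (hyb : y ≤ b) : γR x ≤ slope γ x y :=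
  hconv.le_slope_of_hasDerivWithinAt_Ioi ⟨hax, hxy.le.trans hyb⟩ ⟨hax.trans hxy.le, hyb⟩ hxy
    (h.hasDerivWithinAt_Ioi ⟨hax, hxy.trans_le hyb⟩)

theorem slope_le_left (h : HasOneSidedDerivs γ γR γL a b) (hconv : ConvexOn ℝ (Icc a b) γ)
    {x y : ℝ} (hax : a ≤ x) (hxy : x < y) (hyb : y ≤ b) : slope γ x y ≤ γL y :=
  hconv.slope_le_of_hasDerivWithinAt_Iio ⟨hax, hxy.le.trans hyb⟩ ⟨hax.trans hxy.le, hyb⟩ hxy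
    (h.hasDerivWithinAt_Iio ⟨hax.trans_lt hxy, hyb⟩)

theorem right_le_left (h : HasOneSidedDerivs γ γR γL a b) (hconv : ConvexOn ℝ (Icc a b) γ)
    {x y : ℝ} (hax : a ≤ x) (hxy : x < y) (hyb : y ≤ b) : γR x ≤ γL y :=
  (h.right_le_slope hconv hax hxy hyb).trans (h.slope_le_left hconv hax hxy hyb)

theorem left_le_right (h : HasOneSidedDerivs γ γR γL a b) (hconv : ConvexOn ℝ (Icc a b) γ)
    {x : ℝ} (hx : x ∈ Ioo a b) : γL x ≤ γR x :=
  hconv.leftDeriv_le_rightDeriv_of_hasDerivWithinAt (left_mem_Icc.2 (hx.1.trans hx.2).le)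
    (right_mem_Icc.2 (hx.1.trans hx.2).le) hx.1 hx.2
    (h.hasDerivWithinAt_Iio ⟨hx.1, hx.2.le⟩) (h.hasDerivWithinAt_Ioi ⟨hx.1.le, hx.2⟩)

theorem monotoneOn_right (h : HasOneSidedDerivs γ γR γL a b) (hconv : ConvexOn ℝ (Icc a b) γ) :
    MonotoneOn γR (Ico a b) := by
  intro x hx y hy hxy
  rcases hxy.eq_or_lt with rfl | hlt
  · exact le_rfl
  · exact (h.right_le_left hconv hx.1 hlt hy.2.le).trans
      (h.left_le_right hconv ⟨hx.1.trans_lt hlt, hy.2⟩)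

/-- When all slopes lie in `[0, 1]`, the length of an arc is at most twice its width and its
angle at most the increment of the slope. -/
theorem segW_le (h : HasOneSidedDerivs γ γR γL a b) (hconv : ConvexOn ℝ (Icc a b) γ)
    (hRrange : ∀ x ∈ Ico a b, 0 ≤ γR x ∧ γR x ≤ 1) (hLrange : ∀ x ∈ Ioc a b, 0 ≤ γL x ∧ γL x ≤ 1)
    {x y : ℝ} (hax : a ≤ x) (hxy : x < y) (hyb : y ≤ b) :
    segW γ γR γL x y ≤ 2 * (y - x) * (γL y - γR x) := by
  have hR := hRrange x ⟨hax, hxy.trans_le hyb⟩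
  have hL := hLrange y ⟨hax.trans_lt hxy, hyb⟩
  have hpos : 0 < y - x := sub_pos.2 hxy
  have hs0 := hR.1.trans (h.right_le_slope hconv hax hxy hyb)
  have hs1 := (h.slope_le_left hconv hax hxy hyb).trans hL.2
  rw [slope_def_field] at hs0 hs1
  have hd1 : γ y - γ x ≤ y - x := (div_le_one hpos).1 hs1
  have hd0 : 0 ≤ γ y - γ x := by
    have := mul_nonneg hs0 hpos.le
    rwa [div_mul_cancel₀ _ hpos.ne'] at this
  have hlen : segL γ x y ≤ 2 * (y - x) := by
    refine Real.sqrt_le_iff.2 ⟨by linarith, ?_⟩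
    nlinarith
  have hinc : 0 ≤ γL y - γR x := sub_nonneg.2 (h.right_le_left hconv hax hxy hyb)
  have hden : 1 ≤ 1 + γL y * γR x := le_add_of_nonneg_right (mul_nonneg hL.1 hR.1)
  exact mul_le_mul hlen (div_le_self hinc hden) (div_nonneg hinc (by linarith)) (by linarith)

end HasOneSidedDerivs

theorem sum_range_two_step_sub (g : ℕ → ℝ) (N : ℕ) :
    ∑ i ∈ Finset.range N, (g (i + 2) - g i) = g (N + 1) + g N - g 1 - g 0 := by
  induction N with
  | zero => simp
  | succ k ih => rw [Finset.sum_range_succ, ih]; ring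

theorem statement_7 (a b r : ℝ) (γ γR γL : ℝ → ℝ)
    (hr0 : 0 < r) (hr1 : r ≤ 1)
    (hconv : ConvexOn ℝ (Icc a b) γ)
    (hderiv : HasOneSidedDerivs γ γR γL a b)
    (hRrange : ∀ x ∈ Ico a b, 0 ≤ γR x ∧ γR x ≤ 1)
    (hLrange : ∀ x ∈ Ioc a b, 0 ≤ γL x ∧ γL x ≤ 1)
    (htotal : (b - a) * (γL b - γR a) ≤ 2)
    (ν₁ : ℕ) (s : ℕ → ℝ)
    (hfirst : a ≤ s 0) (hlast : s ν₁ ≤ b)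
    (hmono : ∀ ν, ν < ν₁ → s ν < s (ν + 1))
    (hsep : ∀ ν : ℕ, ν + 3 ≤ ν₁ → r < segW γ γR γL (s ν) (s (ν + 2))) :
    (ν₁ : ℝ) ≤ 2 + 16 / Real.sqrt r := by
  have hsqrt : 0 < Real.sqrt r := Real.sqrt_pos.2 hr0
  rcases Nat.lt_or_ge ν₁ 3 with hn | hn
  · have h2 : (ν₁ : ℝ) ≤ 2 := by exact_mod_cast Nat.le_of_lt_succ hn
    have : 0 ≤ 16 / Real.sqrt r := by positivity
    linarith
  obtain ⟨N, rfl⟩ := Nat.exists_eq_add_of_le' (Nat.le_of_succ_le hn)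
  have hs : StrictMonoOn s (Iic (N + 2)) :=
    strictMonoOn_of_lt_add_one ordConnected_Iic fun ν _ _ hν => hmono ν hν
  have ha : ∀ ν ≤ N + 2, a ≤ s ν := fun ν hν =>
    hfirst.trans (hs.monotoneOn (Nat.zero_le _) hν (Nat.zero_le _))
  have hb : ∀ ν ≤ N + 1, s ν < b := fun ν hν =>
    (hs (show ν ≤ N + 2 by omega) (show N + 2 ≤ N + 2 from le_rfl)
      (show ν < N + 2 by omega)).trans_le hlast
  have hab : a < b := (ha 0 (by omega)).trans_lt (hb 0 (by omega))
  have hstep : ∀ ν < N, s ν < s (ν + 2) := fun ν hν =>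
    hs (show ν ≤ N + 2 by omega) (show ν + 2 ≤ N + 2 by omega) (by omega)
  have hRmono := hderiv.monotoneOn_right hconv
  have hmem : ∀ ν ≤ N + 1, s ν ∈ Ico a b := fun ν hν => ⟨ha ν (by omega), hb ν hν⟩
  have hwidth : ∑ i ∈ Finset.range N, (s (i + 2) - s i) ≤ 2 * (b - a) := by
    rw [sum_range_two_step_sub]
    linarith [hb (N + 1) le_rfl, hb N (by omega), ha 0 (by omega), ha 1 (by omega)]
  have hslope : ∑ i ∈ Finset.range N, (γR (s (i + 2)) - γR (s i)) ≤ 2 * (γL b - γR a) := by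
    rw [sum_range_two_step_sub fun i => γR (s i)]
    have hR : ∀ ν ≤ N + 1, γR a ≤ γR (s ν) ∧ γR (s ν) ≤ γL b := fun ν hν =>
      ⟨hRmono (left_mem_Ico.2 hab) (hmem ν hν) (hmem ν hν).1,
        hderiv.right_le_left hconv (hmem ν hν).1 (hmem ν hν).2 le_rfl⟩
    linarith [(hR (N + 1) le_rfl).2, (hR N (by omega)).2, (hR 0 (by omega)).1,
      (hR 1 (by omega)).1]
  have hinc : ∀ i ∈ Finset.range N, 0 ≤ γR (s (i + 2)) - γR (s i) := fun i hi => by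
    have hi := Finset.mem_range.1 hi
    exact sub_nonneg.2 (hRmono (hmem i (by omega)) (hmem (i + 2) (by omega)) (hstep i hi).le)
  have hterm : ∀ i ∈ Finset.range N,
      Real.sqrt (r / 2) ^ 2 ≤ (s (i + 2) - s i) * (γR (s (i + 2)) - γR (s i)) := by
    intro i hi
    have hi := Finset.mem_range.1 hi
    have hlt := hstep i hi
    have hW := (hsep i (by omega)).trans_le
      (hderiv.segW_le hconv hRrange hLrange (ha i (by omega)) hlt (hb (i + 2) (by omega)).le)
    have hLR := hderiv.left_le_right hconv
      ⟨(ha i (by omega)).trans_lt hlt, hb (i + 2) (by omega)⟩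
    rw [Real.sq_sqrt (by positivity)]
    nlinarith
  have hCS := Finset.sum_sq_le_sum_mul_sum_of_sq_le_mul (Finset.range N)
    (fun i hi => (sub_pos.2 (hstep i (Finset.mem_range.1 hi))).le) hinc hterm
  have hprod := hCS.trans (mul_le_mul hwidth hslope (Finset.sum_nonneg hinc) (by linarith))
  rw [Finset.sum_const, Finset.card_range, nsmul_eq_mul, mul_pow,
    Real.sq_sqrt (by positivity)] at hprod
  have hsq : ((N : ℝ) * Real.sqrt r) ^ 2 ≤ 16 ^ 2 := by
    rw [mul_pow, Real.sq_sqrt hr0.le]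
    nlinarith
  have hN : (N : ℝ) ≤ 16 / Real.sqrt r :=
    (le_div_iff₀ hsqrt).2 (le_of_sq_le_sq hsq (by norm_num))
  push_cast
  linarith
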